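/- Let Ω ⊆ ℝ³ be open, let μ > 0 and λ > −(2/3)μ be real, and let f⃗ ∈ C²(Ω; ℂ³), identified with a purely vectorial ℍ(ℂ)-valued function. Define the Lamé–Navier operator ℒ_{λ,μ}[f⃗] := μ Δ⃗[f⃗] + (μ+λ) grad[div[f⃗]], where Δ⃗[f⃗] := grad[div[f⃗]] − curl[curl[f⃗]]. Set α := (μ+λ)/2 and β := (3μ+λ)/2. Then at every point of Ω: ℒ_{λ,μ}[f⃗] = −(α D_MT[D^r_MT[f⃗]] + β D_MT[D_MT[f⃗]]); in particular, since α ≠ 0 and β ≠ 0, ℒ_{λ,μ}[f⃗] = 0 on Ω if and only if α D_MT[D^r_MT[f⃗]] + β D_MT[D_MT[f⃗]] = 0 on Ω. -/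

import Mathlib

open Quaternion

noncomputable section

/-- Points of `ℝ³`. -/
abbrev P3 := Fin 3 → ℝ
/-- Vectors of `ℂ³`. -/
abbrev V3 := Fin 3 → ℂ

/-- Partial derivative `∂g/∂qᵢ` of a complex-valued function on `ℝ³`. -/
def pd (i : Fin 3) (g : P3 → ℂ) : P3 → ℂ := fun p => fderiv ℝ g p (Pi.single i 1)

/-- Gradient of a scalar field, extended ℂ-linearly. -/
def grad (g : P3 → ℂ) : P3 → V3 := fun p => ![pd 0 g p, pd 1 g p, pd 2 g p]

/-- Divergence of a `ℂ³`-valued vector field. -/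
def div3 (F : P3 → V3) : P3 → ℂ := fun p =>
  pd 0 (fun q => F q 0) p + pd 1 (fun q => F q 1) p + pd 2 (fun q => F q 2) p

/-- Curl of a `ℂ³`-valued vector field. -/
def curl (F : P3 → V3) : P3 → V3 := fun p =>
  ![pd 1 (fun q => F q 2) p - pd 2 (fun q => F q 1) p,
    pd 2 (fun q => F q 0) p - pd 0 (fun q => F q 2) p,
    pd 0 (fun q => F q 1) p - pd 1 (fun q => F q 0) p]

/-- Scalar Laplacian `∂²/∂x² + ∂²/∂y² + ∂²/∂z²` of a complex-valued function. -/
def lap (g : P3 → ℂ) : P3 → ℂ := fun p =>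
  pd 0 (pd 0 g) p + pd 1 (pd 1 g) p + pd 2 (pd 2 g) p

/-- A `ℂ³`-valued field is `Cⁿ` on a set iff each component is. -/
def VContDiffOn (n : ℕ) (F : P3 → V3) (Ω : Set P3) : Prop :=
  ∀ i : Fin 3, ContDiffOn ℝ n (fun q => F q i) Ω

/-- The quaternionic imaginary unit `i₁`. -/
def qi : ℍ[ℂ] := ⟨0, 1, 0, 0⟩
/-- The quaternionic imaginary unit `i₂`. -/
def qj : ℍ[ℂ] := ⟨0, 0, 1, 0⟩
/-- The quaternionic imaginary unit `i₃`. -/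
def qk : ℍ[ℂ] := ⟨0, 0, 0, 1⟩

/-- The complex quaternion with scalar part `s` and vector part `v ∈ ℂ³`. -/
def mkQ (s : ℂ) (v : V3) : ℍ[ℂ] := ⟨s, v 0, v 1, v 2⟩

/-- Scalar part of a complex quaternion. -/
def scQ (a : ℍ[ℂ]) : ℂ := a.re
/-- Vector part of a complex quaternion, identified with a vector in `ℂ³`. -/
def vecQ (a : ℍ[ℂ]) : V3 := ![a.imI, a.imJ, a.imK]

/-- Partial derivative `∂f/∂qᵢ` of an `ℍ(ℂ)`-valued function on `ℝ³`
(computed, as usual for vector-valued functions, componentwise). -/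
def qpd (i : Fin 3) (f : P3 → ℍ[ℂ]) : P3 → ℍ[ℂ] := fun p =>
  ⟨pd i (fun q => (f q).re) p, pd i (fun q => (f q).imI) p,
   pd i (fun q => (f q).imJ) p, pd i (fun q => (f q).imK) p⟩

/-- The Moisil–Theodoresco operator `D_MT[f] = i₁ ∂f/∂x + i₂ ∂f/∂y + i₃ ∂f/∂z`
(quaternionic multiplication on the left). -/
def DMT (f : P3 → ℍ[ℂ]) : P3 → ℍ[ℂ] := fun p =>
  qi * qpd 0 f p + qj * qpd 1 f p + qk * qpd 2 f p

/-- The right Moisil–Theodoresco operator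
`D^r_MT[f] = (∂f/∂x) i₁ + (∂f/∂y) i₂ + (∂f/∂z) i₃`. -/
def DMTr (f : P3 → ℍ[ℂ]) : P3 → ℍ[ℂ] := fun p =>
  qpd 0 f p * qi + qpd 1 f p * qj + qpd 2 f p * qk

/-- An `ℍ(ℂ)`-valued function is `Cⁿ` on a set iff each of its four
complex component functions is. -/
def QContDiffOn (n : ℕ) (f : P3 → ℍ[ℂ]) (Ω : Set P3) : Prop :=
  ContDiffOn ℝ n (fun q => (f q).re) Ω ∧ ContDiffOn ℝ n (fun q => (f q).imI) Ω ∧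
    ContDiffOn ℝ n (fun q => (f q).imJ) Ω ∧ ContDiffOn ℝ n (fun q => (f q).imK) Ω

/-- The scalar part `f₀` of an `ℍ(ℂ)`-valued function. -/
def sc (f : P3 → ℍ[ℂ]) : P3 → ℂ := fun q => (f q).re
/-- The vector part `f⃗` of an `ℍ(ℂ)`-valued function, as a `ℂ³`-valued field. -/
def vf (f : P3 → ℍ[ℂ]) : P3 → V3 := fun q => vecQ (f q)

@[simp] theorem re_qi : qi.re = 0 := rfl
@[simp] theorem imI_qi : qi.imI = 1 := rfl
@[simp] theorem imJ_qi : qi.imJ = 0 := rfl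
@[simp] theorem imK_qi : qi.imK = 0 := rfl
@[simp] theorem re_qj : qj.re = 0 := rfl
@[simp] theorem imI_qj : qj.imI = 0 := rfl
@[simp] theorem imJ_qj : qj.imJ = 1 := rfl
@[simp] theorem imK_qj : qj.imK = 0 := rfl
@[simp] theorem re_qk : qk.re = 0 := rfl
@[simp] theorem imI_qk : qk.imI = 0 := rfl
@[simp] theorem imJ_qk : qk.imJ = 0 := rfl
@[simp] theorem imK_qk : qk.imK = 1 := rfl

@[simp] theorem re_mkQ (s : ℂ) (v : V3) : (mkQ s v).re = s := rfl
@[simp] theorem imI_mkQ (s : ℂ) (v : V3) : (mkQ s v).imI = v 0 := rfl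
@[simp] theorem imJ_mkQ (s : ℂ) (v : V3) : (mkQ s v).imJ = v 1 := rfl
@[simp] theorem imK_mkQ (s : ℂ) (v : V3) : (mkQ s v).imK = v 2 := rfl

@[simp] theorem re_qpd (i : Fin 3) (f : P3 → ℍ[ℂ]) (p : P3) :
    (qpd i f p).re = pd i (fun q => (f q).re) p := rfl
@[simp] theorem imI_qpd (i : Fin 3) (f : P3 → ℍ[ℂ]) (p : P3) :
    (qpd i f p).imI = pd i (fun q => (f q).imI) p := rfl
@[simp] theorem imJ_qpd (i : Fin 3) (f : P3 → ℍ[ℂ]) (p : P3) :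
    (qpd i f p).imJ = pd i (fun q => (f q).imJ) p := rfl
@[simp] theorem imK_qpd (i : Fin 3) (f : P3 → ℍ[ℂ]) (p : P3) :
    (qpd i f p).imK = pd i (fun q => (f q).imK) p := rfl

/-- The Moisil–Theodoresco operator in terms of `grad`, `div` and `curl`. -/
theorem DMT_mkQ (s : P3 → ℂ) (v : P3 → V3) :
    DMT (fun q => mkQ (s q) (v q)) = fun p => mkQ (-div3 v p) (grad s p + curl v p) := by
  funext p
  ext <;> simp [DMT, div3, grad, curl] <;> ring

/-- The right Moisil–Theodoresco operator in terms of `grad`, `div` and `curl`. -/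
theorem DMTr_mkQ (s : P3 → ℂ) (v : P3 → V3) :
    DMTr (fun q => mkQ (s q) (v q)) = fun p => mkQ (-div3 v p) (grad s p - curl v p) := by
  funext p
  ext <;> simp [DMTr, div3, grad, curl] <;> ring

theorem pd_neg (i : Fin 3) (g : P3 → ℂ) (p : P3) : pd i (fun q => -g q) p = -pd i g p := by
  simp [pd, fderiv_fun_neg]

theorem pd_sub {g h : P3 → ℂ} {p : P3} (i : Fin 3) (hg : DifferentiableAt ℝ g p)
    (hh : DifferentiableAt ℝ h p) : pd i (fun q => g q - h q) p = pd i g p - pd i h p := by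
  simp [pd, fderiv_fun_sub hg hh]

theorem grad_zero (p : P3) : grad (fun _ => 0) p = 0 := by
  ext i; fin_cases i <;> simp [grad, pd]

theorem grad_neg (g : P3 → ℂ) (p : P3) : grad (fun q => -g q) p = -grad g p := by
  ext i; fin_cases i <;> simp [grad, pd_neg]

theorem div3_neg (v : P3 → V3) (p : P3) : div3 (fun q => -v q) p = -div3 v p := by
  simp only [div3, Pi.neg_apply, pd_neg]; ring

theorem curl_neg (v : P3 → V3) (p : P3) : curl (fun q => -v q) p = -curl v p := by
  ext i; fin_cases i <;> simp [curl, pd_neg] <;> ring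

theorem ContDiffAt.differentiableAt_fderiv_of_two {g : P3 → ℂ} {p : P3}
    (hg : ContDiffAt ℝ 2 g p) : DifferentiableAt ℝ (fderiv ℝ g) p :=
  (hg.fderiv_right (m := 1) (by norm_num)).differentiableAt (by norm_num)

theorem ContDiffAt.differentiableAt_pd {g : P3 → ℂ} {p : P3}
    (hg : ContDiffAt ℝ 2 g p) (i : Fin 3) : DifferentiableAt ℝ (pd i g) p :=
  hg.differentiableAt_fderiv_of_two.clm_apply (differentiableAt_const _)

/-- Symmetry of the second partial derivatives of a `C²` function. -/
theorem ContDiffAt.pd_comm {g : P3 → ℂ} {p : P3}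
    (hg : ContDiffAt ℝ 2 g p) (i j : Fin 3) : pd i (pd j g) p = pd j (pd i g) p := by
  have key (k l : Fin 3) : pd k (pd l g) p =
      fderiv ℝ (fderiv ℝ g) p (Pi.single k 1) (Pi.single l 1) := by
    change fderiv ℝ (fun q => fderiv ℝ g q (Pi.single l 1)) p (Pi.single k 1) = _
    rw [fderiv_clm_apply hg.differentiableAt_fderiv_of_two (differentiableAt_const _)]
    simp
  rw [key, key]
  exact (hg.isSymmSndFDerivAt (by simp)).eq _ _

/-- The divergence of the curl of a `C²` field vanishes. -/
theorem div3_curl {F : P3 → V3} {p : P3} (hF : ∀ i, ContDiffAt ℝ 2 (fun q => F q i) p) :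
    div3 (curl F) p = 0 := by
  have hd (i j : Fin 3) := (hF i).differentiableAt_pd j
  have e (k i j i' j' : Fin 3) := pd_sub k (hd i j) (hd i' j')
  simp only [div3, curl, Matrix.cons_val, e]
  rw [(hF 2).pd_comm 0 1, (hF 1).pd_comm 0 2, (hF 0).pd_comm 1 2]
  ring

theorem mkQ_zero_eq_zero {v : V3} : mkQ 0 v = 0 ↔ v = 0 := by
  simp [Quaternion.ext_iff, funext_iff, Fin.forall_fin_succ]

/-- Let `μ > 0`, `λ > −(2/3)μ` and let `f⃗ ∈ C²(Ω; ℂ³)` be identified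
with a purely vectorial `ℍ(ℂ)`-valued function.  With the Lamé–Navier operator
`ℒ_{λ,μ}[f⃗] = μ Δ⃗[f⃗] + (μ+λ) grad[div[f⃗]]`, `Δ⃗ = grad∘div − curl∘curl`,
`α = (μ+λ)/2` and `β = (3μ+λ)/2`, one has at every point of `Ω`:
`ℒ_{λ,μ}[f⃗] = −(α D_MT[D^r_MT[f⃗]] + β D_MT[D_MT[f⃗]])`; in particular (`α ≠ 0 ≠ β`),
`ℒ_{λ,μ}[f⃗] = 0` on `Ω` iff `α D_MT[D^r_MT[f⃗]] + β D_MT[D_MT[f⃗]] = 0` on `Ω`. -/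
theorem lame_navier_DMT_factorization (Ω : Set P3) (hΩ : IsOpen Ω) (μ lam : ℝ)
    (hμ : 0 < μ) (hlam : -(2/3) * μ < lam) (F : P3 → V3) (hF : VContDiffOn 2 F Ω) :
    (∀ p ∈ Ω,
      mkQ 0 ((μ : ℂ) • (grad (div3 F) p - curl (curl F) p) +
          ((μ : ℂ) + (lam : ℂ)) • grad (div3 F) p) =
        -((((μ + lam)/2 : ℝ) : ℂ) • DMT (DMTr (fun q => mkQ 0 (F q))) p +
          (((3*μ + lam)/2 : ℝ) : ℂ) • DMT (DMT (fun q => mkQ 0 (F q))) p)) ∧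
    ((∀ p ∈ Ω,
        (μ : ℂ) • (grad (div3 F) p - curl (curl F) p) +
          ((μ : ℂ) + (lam : ℂ)) • grad (div3 F) p = 0) ↔
      (∀ p ∈ Ω,
        (((μ + lam)/2 : ℝ) : ℂ) • DMT (DMTr (fun q => mkQ 0 (F q))) p +
          (((3*μ + lam)/2 : ℝ) : ℂ) • DMT (DMT (fun q => mkQ 0 (F q))) p = 0)) := by
  have main : ∀ p ∈ Ω,
      mkQ 0 ((μ : ℂ) • (grad (div3 F) p - curl (curl F) p) +
          ((μ : ℂ) + (lam : ℂ)) • grad (div3 F) p) =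
        -((((μ + lam)/2 : ℝ) : ℂ) • DMT (DMTr (fun q => mkQ 0 (F q))) p +
          (((3*μ + lam)/2 : ℝ) : ℂ) • DMT (DMT (fun q => mkQ 0 (F q))) p) := by
    intro p hp
    have h0 : div3 (curl F) p = 0 :=
      div3_curl fun i => (hF i).contDiffAt (hΩ.mem_nhds hp)
    simp only [DMT_mkQ, DMTr_mkQ, grad_zero, zero_add, zero_sub, grad_neg, div3_neg, curl_neg, h0]
    ext <;> simp <;> ring
  refine ⟨main, forall₂_congr fun p hp => ?_⟩
  rw [← mkQ_zero_eq_zero, main p hp, neg_eq_zero]
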